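/- Let p and q be complex polynomials with no common root, not both constant, and let B = max(deg p, deg q). Let R = p/q, a meromorphic function on ℂ whose derivative R′ is defined away from the zero set of q. Then the integral over ℂ (with respect to two-dimensional Lebesgue measure, the zero set of q being a null set) of |R′(z)|² / (1 + |R(z)|²)² equals π·B. -/

import Mathlib

open Polynomial MeasureTheory
open scoped Real

lemma fs_g_integral : ∫ w : ℂ, 1 / (1 + ‖w‖ ^ 2) ^ 2 = π := by
  rw [integral_fun_norm_addHaar volume (fun r : ℝ => 1 / (1 + r ^ 2) ^ 2)]
  have h : ∫ y in Set.Ioi (0 : ℝ), y ^ (Module.finrank ℝ ℂ - 1) • (1 / (1 + y ^ 2) ^ 2)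
      = 0 - (-(1/2) * (1 + (0:ℝ) ^ 2)⁻¹) := by
    apply integral_Ioi_of_hasDerivAt_of_nonneg' (g := fun y : ℝ => -(1/2) * (1 + y ^ 2)⁻¹)
    · intro x _
      have h1 : (1 + x ^ 2) ≠ 0 := by positivity
      have := ((((hasDerivAt_id x).pow 2).const_add 1).inv h1).const_mul (-(1/2) : ℝ)
      convert! this using 1
      simp [Complex.finrank_real_complex]
      field_simp
    · intro x hx
      have : 0 ≤ x := le_of_lt hx
      simp only [smul_eq_mul]; positivity
    · have : Filter.Tendsto (fun y : ℝ => 1 + y ^ 2) Filter.atTop Filter.atTop :=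
        Filter.tendsto_atTop_add_const_left _ _ (Filter.tendsto_pow_atTop (by norm_num))
      simpa using this.inv_tendsto_atTop.const_mul (-(1/2) : ℝ)
  rw [h]
  simp [Complex.finrank_real_complex, Measure.real, Complex.volume_ball]
  ring

lemma fs_g_lintegral : ∫⁻ w : ℂ, ENNReal.ofReal (1 / (1 + ‖w‖ ^ 2) ^ 2) = ENNReal.ofReal π := by
  rw [← fs_g_integral, ofReal_integral_eq_lintegral_ofReal]
  · by_contra h
    have := integral_undef h
    rw [fs_g_integral] at this
    exact Real.pi_ne_zero this
  · exact Filter.Eventually.of_forall fun w => by positivity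

lemma fs_det (c : ℂ) :
    ((ContinuousLinearMap.toSpanSingleton ℂ c).restrictScalars ℝ : ℂ →L[ℝ] ℂ).det = ‖c‖ ^ 2 := by
  simp [ContinuousLinearMap.det, LinearMap.det_restrictScalars,
      Algebra.norm_complex_eq, Complex.normSq_eq_norm_sq]

lemma fs_locinj {R R' : ℂ → ℂ} {U : Set ℂ}
    (hR : ∀ z ∈ U, HasStrictDerivAt R (R' z) z) (h0 : ∀ z ∈ U, R' z ≠ 0) :
    ∃ V : ℕ → Set ℂ, (∀ n, IsOpen (V n)) ∧ (∀ n, Set.InjOn R (V n)) ∧ U ⊆ ⋃ n, V n := by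
  have : ∀ z : ℂ, ∃ W : Set ℂ, IsOpen W ∧ Set.InjOn R W ∧ (z ∈ U → z ∈ W) := by
    intro z
    by_cases hz : z ∈ U
    · let e := ((hR z hz).hasStrictFDerivAt_equiv (h0 z hz)).toOpenPartialHomeomorph R
      exact ⟨e.source, e.open_source, e.injOn,
        fun _ => HasStrictFDerivAt.mem_toOpenPartialHomeomorph_source _⟩
    · exact ⟨∅, isOpen_empty, by simp, fun h => absurd h hz⟩
  choose W hW1 hW2 hW3 using this
  obtain ⟨t, htU, htc, ht⟩ := TopologicalSpace.countable_cover_nhdsWithin (s := U) (f := W)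
    fun z hz => mem_nhdsWithin_of_mem_nhds ((hW1 z).mem_nhds (hW3 z hz))
  rcases t.eq_empty_or_nonempty with rfl | hne
  · exact ⟨fun _ => ∅, fun _ => isOpen_empty, by simp, by simpa using ht⟩
  · obtain ⟨f, rfl⟩ := htc.exists_eq_range hne
    exact ⟨fun n => W (f n), fun n => hW1 _, fun n => hW2 _, by simpa using ht⟩

lemma fs_area {R R' : ℂ → ℂ} {U : Set ℂ} (hU : MeasurableSet U)
    (hR : ∀ z ∈ U, HasStrictDerivAt R (R' z) z) (h0 : ∀ z ∈ U, R' z ≠ 0)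
    (g : ℂ → ENNReal) (hg : Measurable g) (B : ℕ)
    (hB : ∀ᵐ w : ℂ, ∃ F : Finset ℂ, F.card = B ∧ ∀ z, z ∈ F ↔ z ∈ U ∧ R z = w) :
    ∫⁻ z in U, ENNReal.ofReal (‖R' z‖ ^ 2) * g (R z) = B * ∫⁻ w, g w := by
  obtain ⟨V, hV1, hV2, hV3⟩ := fs_locinj hR h0
  set T : ℕ → Set ℂ := fun n => disjointed V n ∩ U with hT
  have hTm : ∀ n, MeasurableSet (T n) := fun n =>
    (MeasurableSet.disjointed (fun n => (hV1 n).measurableSet) n).inter hU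
  have hTd : Pairwise (Function.onFun Disjoint T) := fun i j hij =>
    (disjoint_disjointed V hij).mono Set.inter_subset_left Set.inter_subset_left
  have hTU : ⋃ n, T n = U := by
    rw [hT, ← Set.iUnion_inter, iUnion_disjointed]
    exact Set.inter_eq_right.2 hV3
  have hTi : ∀ n, Set.InjOn R (T n) := fun n =>
    (hV2 n).mono (Set.inter_subset_left.trans (disjointed_subset V n))
  have hd : ∀ n, ∀ z ∈ T n, HasFDerivWithinAt R
      ((ContinuousLinearMap.toSpanSingleton ℂ (R' z)).restrictScalars ℝ) (T n) z := fun n z hz =>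
    (((hR z hz.2).hasDerivAt.hasFDerivAt).restrictScalars ℝ).hasFDerivWithinAt
  have him : ∀ n, MeasurableSet (R '' T n) := fun n =>
    measurable_image_of_fderivWithin (hTm n) (hd n) (hTi n)
  calc ∫⁻ z in U, ENNReal.ofReal (‖R' z‖ ^ 2) * g (R z)
      = ∑' n, ∫⁻ z in T n, ENNReal.ofReal (‖R' z‖ ^ 2) * g (R z) := by
        rw [← hTU, lintegral_iUnion hTm hTd]
    _ = ∑' n, ∫⁻ w in R '' T n, g w := by
        congr 1; ext n
        rw [lintegral_image_eq_lintegral_abs_det_fderiv_mul volume (hTm n) (hd n) (hTi n)]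
        simp_rw [fs_det, abs_pow, abs_norm]
    _ = ∑' n, ∫⁻ w, (R '' T n).indicator g w := by
        congr 1; ext n; rw [lintegral_indicator (him n)]
    _ = ∫⁻ w, ∑' n, (R '' T n).indicator g w := by
        rw [lintegral_tsum fun n => (hg.indicator (him n)).aemeasurable]
    _ = ∫⁻ w, B * g w := by
        apply lintegral_congr_ae
        filter_upwards [hB] with w ⟨F, hF, hFw⟩
        have key : ∀ n, (R '' T n).indicator g w = Measure.count ((F : Set ℂ) ∩ T n) * g w := by
          intro n
          by_cases hw : w ∈ R '' T n
          · obtain ⟨z, hz, rfl⟩ := hw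
            have : (F : Set ℂ) ∩ T n = {z} := by
              ext y
              simp only [Set.mem_inter_iff, Finset.mem_coe, hFw, Set.mem_singleton_iff]
              constructor
              · rintro ⟨⟨_, h⟩, hy⟩
                exact hTi n hy hz h
              · rintro rfl
                exact ⟨⟨hz.2, rfl⟩, hz⟩
            rw [Set.indicator_of_mem (Set.mem_image_of_mem R hz), this, Measure.count_singleton, one_mul]
          · have : (F : Set ℂ) ∩ T n = ∅ := by
              ext y
              simp only [Set.mem_inter_iff, Finset.mem_coe, hFw, Set.mem_empty_iff_false, iff_false]
              rintro ⟨⟨_, h⟩, hy⟩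
              exact hw ⟨y, hy, h⟩
            rw [Set.indicator_of_notMem hw, this, measure_empty, zero_mul]
        simp_rw [key]
        rw [ENNReal.tsum_mul_right, ← measure_iUnion, ← Set.inter_iUnion, hTU,
          Set.inter_eq_left.2 (fun z hz => ((hFw z).1 hz).1), Measure.count_apply_finset, hF]
        · exact fun i j hij => (hTd hij).mono Set.inter_subset_right Set.inter_subset_right
        · exact fun n => F.measurableSet.inter (hTm n)
    _ = B * ∫⁻ w, g w := lintegral_const_mul _ hg

lemma fs_wronskian_ne (p q : Polynomial ℂ)
    (hc : IsCoprime p q) (hB : 1 ≤ max p.natDegree q.natDegree) :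
    derivative p * q - p * derivative q ≠ 0 := by
  intro h
  have h : derivative p * q = p * derivative q := sub_eq_zero.1 h
  have h1 : q ∣ derivative q := hc.symm.dvd_of_dvd_mul_left ⟨derivative p, by rw [← h]; ring⟩
  have h2 : p ∣ derivative p := hc.dvd_of_dvd_mul_right ⟨derivative q, h⟩
  have key : ∀ r : Polynomial ℂ, r ∣ derivative r → r.natDegree = 0 := by
    intro r hr
    by_contra hne
    have hlt := natDegree_derivative_lt hne
    have h0 := eq_zero_of_dvd_of_natDegree_lt hr hlt
    exact hne (derivative_eq_zero.1 h0)
  rw [key p h2, key q h1] at hB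
  simp at hB

lemma fs_coprime (p q : Polynomial ℂ)
    (hnoroot : ∀ z : ℂ, ¬(p.eval z = 0 ∧ q.eval z = 0)) : IsCoprime p q := by
  rw [Polynomial.isCoprime_iff_aeval_ne_zero_of_isAlgClosed ℂ ℂ]
  intro z
  have := hnoroot z
  simp only [coe_aeval_eq_eval]
  tauto

lemma fs_natDegree (p q : Polynomial ℂ) :
    ∀ᵐ w : ℂ, (p - C w * q).natDegree = max p.natDegree q.natDegree := by
  have : ∀ᵐ w : ℂ, w ≠ p.leadingCoeff / q.leadingCoeff ∧ w ≠ 0 := by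
    refine Filter.Eventually.and ?_ ?_ <;> exact Measure.ae_ne _ _
  filter_upwards [this] with w ⟨hw, hw0⟩
  have hCq : (C w * q).natDegree = q.natDegree := natDegree_C_mul hw0
  rcases lt_trichotomy p.natDegree q.natDegree with h | h | h
  · rw [natDegree_sub_eq_right_of_natDegree_lt (by rwa [hCq]), hCq, max_eq_right h.le]
  · rw [← h, max_self]
    apply le_antisymm
    · refine (natDegree_sub_le _ _).trans ?_
      rw [hCq, h]; simp
    · by_cases hq : q = 0
      · simp [hq]
      apply le_natDegree_of_ne_zero
      rw [coeff_sub, coeff_C_mul]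
      intro h0
      apply hw
      rw [eq_div_iff (by simpa using hq), leadingCoeff, leadingCoeff, ← h]
      exact (sub_eq_zero.1 h0).symm
  · rw [natDegree_sub_eq_left_of_natDegree_lt (by rwa [hCq]), max_eq_left h.le]

lemma fs_fiber (p q : Polynomial ℂ)
    (hnoroot : ∀ z : ℂ, ¬(p.eval z = 0 ∧ q.eval z = 0))
    (hB : 1 ≤ max p.natDegree q.natDegree) :
    ∀ᵐ w : ℂ, ∃ F : Finset ℂ, F.card = max p.natDegree q.natDegree ∧
      ∀ z, z ∈ F ↔ z ∈ {z | q.eval z ≠ 0 ∧ (derivative p * q - p * derivative q).eval z ≠ 0} ∧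
        p.eval z / q.eval z = w := by
  have hW := fs_wronskian_ne p q (fs_coprime p q hnoroot) hB
  set W := derivative p * q - p * derivative q with hWdef
  have hfin : ∀ᵐ w : ℂ, w ∉ (fun z => p.eval z / q.eval z) '' (W.roots.toFinset : Set ℂ) :=
    measure_eq_zero_iff_ae_notMem.1 (((Finset.finite_toSet _).image _).measure_zero _)
  filter_upwards [fs_natDegree p q, hfin] with w hdeg hw
  have hne : p - C w * q ≠ 0 := by
    intro h
    rw [h, natDegree_zero] at hdeg
    omega
  have hroot : ∀ z, (p - C w * q).eval z = 0 ↔ q.eval z ≠ 0 ∧ p.eval z / q.eval z = w := by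
    intro z
    simp only [eval_sub, eval_mul, eval_C, sub_eq_zero]
    constructor
    · intro h
      have hq : q.eval z ≠ 0 := fun hq => hnoroot z ⟨by rw [h, hq, mul_zero], hq⟩
      exact ⟨hq, by rw [h]; field_simp⟩
    · rintro ⟨hq, rfl⟩
      field_simp
  have hWz : ∀ z, (p - C w * q).eval z = 0 → W.eval z ≠ 0 := by
    intro z hz h
    exact hw ⟨z, by simpa [hW] using h, ((hroot z).1 hz).2⟩
  have hnodup : (p - C w * q).roots.Nodup := by
    rw [Multiset.nodup_iff_count_le_one]
    intro z
    rw [count_roots]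
    by_contra hlt
    rw [not_le, one_lt_rootMultiplicity_iff_isRoot hne] at hlt
    obtain ⟨h1, h2⟩ := hlt
    apply hWz z h1
    have h1' : p.eval z = w * q.eval z := by
      simpa [sub_eq_zero] using h1
    have h2' : (derivative p).eval z = w * (derivative q).eval z := by
      simpa [sub_eq_zero] using h2
    simp only [hWdef, eval_sub, eval_mul, h1', h2']
    ring
  refine ⟨(p - C w * q).roots.toFinset, ?_, ?_⟩
  · rw [Multiset.toFinset_card_of_nodup hnodup, ← hdeg]
    exact ((IsAlgClosed.splits _).natDegree_eq_card_roots).symm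
  · intro z
    rw [Multiset.mem_toFinset, mem_roots hne, IsRoot.def]
    constructor
    · intro h
      exact ⟨⟨((hroot z).1 h).1, hWz z h⟩, ((hroot z).1 h).2⟩
    · rintro ⟨⟨h1, _⟩, h2⟩
      exact (hroot z).2 ⟨h1, h2⟩

/-- For coprime complex polynomials `p, q`, not both constant, with
`B = max(deg p, deg q)`, the integral over `ℂ` of `|R'(z)|²/(1+|R(z)|²)²` for the
rational map `R = p/q` equals `π·B` (the degree of `R` times the area `π` of the
half-sphere under stereographic pullback normalization). -/
theorem integral_pullback_fubiniStudy_eq_degree (p q : Polynomial ℂ)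
    (hnoroot : ∀ z : ℂ, ¬(p.eval z = 0 ∧ q.eval z = 0))
    (hB : 1 ≤ max p.natDegree q.natDegree) :
    ∫ z : ℂ,
        ‖deriv (fun w => p.eval w / q.eval w) z‖ ^ 2 /
          (1 + ‖p.eval z / q.eval z‖ ^ 2) ^ 2
      = π * (max p.natDegree q.natDegree : ℝ) := by
  have hW := fs_wronskian_ne p q (fs_coprime p q hnoroot) hB
  have hq : q ≠ 0 := by
    rintro rfl
    simp at hW
  have hfib := fs_fiber p q hnoroot hB
  set W := derivative p * q - p * derivative q with hWdef
  set R : ℂ → ℂ := fun w => p.eval w / q.eval w with hRdef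
  set U : Set ℂ := {z | q.eval z ≠ 0 ∧ W.eval z ≠ 0} with hUdef
  have hUo : IsOpen U := (isOpen_ne_fun q.continuous continuous_const).inter
    (isOpen_ne_fun W.continuous continuous_const)
  have hUc : volume Uᶜ = 0 := by
    apply Set.Finite.measure_zero
    refine Set.Finite.subset ((q * W).roots.toFinset.finite_toSet) ?_
    intro z hz
    have : ¬ (q.eval z ≠ 0 ∧ W.eval z ≠ 0) := hz
    simp only [Finset.mem_coe, Multiset.mem_toFinset, mem_roots (mul_ne_zero hq hW), IsRoot.def,
      eval_mul, mul_eq_zero]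
    tauto
  have hR1 : ∀ z ∈ U, HasStrictDerivAt R (W.eval z / q.eval z ^ 2) z := by
    intro z hz
    have := (p.hasStrictDerivAt z).div (q.hasStrictDerivAt z) hz.1
    simpa [hWdef] using! this
  have hR : ∀ z ∈ U, HasStrictDerivAt R (deriv R z) z := fun z hz => by
    rw [(hR1 z hz).hasDerivAt.deriv]; exact hR1 z hz
  have h0 : ∀ z ∈ U, deriv R z ≠ 0 := fun z hz => by
    rw [(hR1 z hz).hasDerivAt.deriv]
    exact div_ne_zero hz.2 (pow_ne_zero _ hz.1)
  have hgm : Measurable fun w : ℂ => ENNReal.ofReal (1 / (1 + ‖w‖ ^ 2) ^ 2) := by fun_prop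
  have main := fs_area hUo.measurableSet hR h0 _ hgm _ hfib
  rw [fs_g_lintegral] at main
  have hRm : Measurable R := p.continuous.measurable.div q.continuous.measurable
  rw [integral_eq_lintegral_of_nonneg_ae (Filter.Eventually.of_forall fun z => by positivity)
    (Measurable.aestronglyMeasurable (by
      have h1 := measurable_deriv R
      have h2 : Measurable fun z => p.eval z / q.eval z := hRm
      exact (h1.norm.pow_const 2).div (((h2.norm.pow_const 2).const_add 1).pow_const 2)))]
  rw [← setLIntegral_univ, ← setLIntegral_congr (ae_eq_univ.2 hUc)]
  have : ∀ z, ENNReal.ofReal (‖deriv R z‖ ^ 2 / (1 + ‖p.eval z / q.eval z‖ ^ 2) ^ 2)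
      = ENNReal.ofReal (‖deriv R z‖ ^ 2) * ENNReal.ofReal (1 / (1 + ‖R z‖ ^ 2) ^ 2) := by
    intro z
    rw [← ENNReal.ofReal_mul (by positivity), mul_one_div]
  simp_rw [this]
  rw [main]
  simp [ENNReal.toReal_ofReal Real.pi_pos.le, mul_comm]
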